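/- Let n ≥ 2 and let A_1, …, A_{2^{n−1}} be dichotomic observables on ℂ^d. For y ∈ {1,…,n} define A'_y = Σ_{x=1}^{2^{n−1}} (−1)^{z_y^x} A_x. Then the matrix 4^{n−1}·I − Σ_{y=1}^n (A'_y)² is positive semidefinite; consequently, for every density matrix ρ on ℂ^d, Σ_{y=1}^n Tr[(A'_y)² ρ] ≤ 4^{n−1}. -/

import Mathlib

open Matrix Kronecker BigOperators
open scoped ComplexOrder

noncomputable section

/-- A dichotomic observable: a Hermitian matrix squaring to the identity. -/
def IsDichotomic {I : Type} [Fintype I] [DecidableEq I] (O : Matrix I I ℂ) : Prop :=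
  O.IsHermitian ∧ O * O = 1

/-- A density matrix: positive semidefinite with trace one. -/
def IsDensity {I : Type} [Fintype I] [DecidableEq I] (ρ : Matrix I I ℂ) : Prop :=
  ρ.PosSemidef ∧ ρ.trace = 1

/-- The sign `(-1)^{z_y^x}`, where `z_y^x` is the bit in position `n - y`
(here `y : Fin n` represents the setting `y+1`, `x : Fin (2^(n-1))` represents `x+1`,
so the bit is that of `x` in position `n - 1 - y`). -/
def bellSign (n : ℕ) (y : Fin n) (x : Fin (2 ^ (n - 1))) : ℝ :=
  if (x : ℕ).testBit (n - 1 - (y : ℕ)) then -1 else 1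

/-- The Bell value `𝓘_n(A, B, ρ) = Σ_y Σ_x (-1)^{z_y^x} Tr[(A_x ⊗ B_y) ρ]`. -/
def bellValue (n : ℕ) {IA IB : Type} [Fintype IA] [Fintype IB]
    (A : Fin (2 ^ (n - 1)) → Matrix IA IA ℂ) (B : Fin n → Matrix IB IB ℂ)
    (ρ : Matrix (IA × IB) (IA × IB) ℂ) : ℝ :=
  ∑ y : Fin n, ∑ x : Fin (2 ^ (n - 1)), bellSign n y x * (((A x ⊗ₖ B y) * ρ).trace).re

/-- The local bound `L_n = (⌊n/2⌋+1)·C(n, ⌊n/2⌋+1)`. -/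
def localBound (n : ℕ) : ℝ := ((n / 2 + 1) * Nat.choose n (n / 2 + 1) : ℕ)


/-- The scaled sum `A'_y = Σ_x (-1)^{z_y^x} A_x`. -/
def primedObs (n : ℕ) {I : Type} [Fintype I]
    (A : Fin (2 ^ (n - 1)) → Matrix I I ℂ) (y : Fin n) : Matrix I I ℂ :=
  ∑ x : Fin (2 ^ (n - 1)), (bellSign n y x : ℂ) • A x

theorem bellSign_mul_self (n : ℕ) (y : Fin n) (x : Fin (2 ^ (n - 1))) :
    bellSign n y x * bellSign n y x = 1 := by
  unfold bellSign; split <;> norm_num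

/-- Distinct sign vectors are orthogonal: flipping the bit read by the later setting changes
exactly one of the two signs. -/
theorem sum_bellSign_mul_of_lt (n : ℕ) {y z : Fin n} (hyz : y < z) :
    ∑ x, bellSign n y x * bellSign n z x = 0 := by
  have hlt : (y : ℕ) < z := hyz
  have hz := z.isLt
  set b := n - 1 - (z : ℕ) with hb
  have hpow : 2 ^ b < 2 ^ (n - 1) := Nat.pow_lt_pow_right (by norm_num) (by omega)
  let flip : Fin (2 ^ (n - 1)) → Fin (2 ^ (n - 1)) :=
    fun x => ⟨(x : ℕ) ^^^ 2 ^ b, Nat.xor_lt_two_pow x.isLt hpow⟩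
  have hflip : Function.Involutive flip := fun x => Fin.ext (by simp [flip])
  have hy (x) : bellSign n y (flip x) = bellSign n y x := by
    have : b ≠ n - 1 - (y : ℕ) := by omega
    simp [bellSign, flip, Nat.testBit_xor, this]
  have hz' (x) : bellSign n z (flip x) = -bellSign n z x := by
    simp only [bellSign, flip, Nat.testBit_xor, ← hb, Nat.testBit_two_pow_self]
    cases (x : ℕ).testBit b <;> simp
  have h := Equiv.sum_comp hflip.toPerm fun x => bellSign n y x * bellSign n z x
  simp only [Function.Involutive.coe_toPerm, hy, hz', mul_neg, Finset.sum_neg_distrib] at h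
  linarith

theorem sum_bellSign_mul (n : ℕ) (y z : Fin n) :
    ∑ x, bellSign n y x * bellSign n z x = if y = z then (2 : ℝ) ^ (n - 1) else 0 := by
  rcases lt_trichotomy y z with h | rfl | h
  · rw [if_neg h.ne, sum_bellSign_mul_of_lt n h]
  · simp [bellSign_mul_self]
  · simp_rw [if_neg h.ne', mul_comm (bellSign n y _), sum_bellSign_mul_of_lt n h]

theorem isHermitian_primedObs (n : ℕ) {I : Type} [Fintype I]
    {A : Fin (2 ^ (n - 1)) → Matrix I I ℂ} (hA : ∀ x, (A x).IsHermitian) (y : Fin n) :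
    (primedObs n A y).IsHermitian := by
  simp [IsHermitian, primedObs, conjTranspose_sum, conjTranspose_smul, (hA _).eq]

/-- The residual of `A_x` after projecting the family `A` onto the sign vectors. -/
def residualObs (n : ℕ) {I : Type} [Fintype I]
    (A : Fin (2 ^ (n - 1)) → Matrix I I ℂ) (x : Fin (2 ^ (n - 1))) : Matrix I I ℂ :=
  (2 : ℂ) ^ (n - 1) • A x - ∑ y, (bellSign n y x : ℂ) • primedObs n A y

theorem isHermitian_residualObs (n : ℕ) {I : Type} [Fintype I]
    {A : Fin (2 ^ (n - 1)) → Matrix I I ℂ} (hA : ∀ x, (A x).IsHermitian)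
    (x : Fin (2 ^ (n - 1))) : (residualObs n A x).IsHermitian := by
  simp [IsHermitian, residualObs, conjTranspose_sum, conjTranspose_smul, (hA _).eq,
    (isHermitian_primedObs n hA _).eq]

/-- Bessel's identity for the orthogonal sign vectors, with matrix coefficients. -/
theorem sum_residualObs_mul_self (n : ℕ) {I : Type} [Fintype I] [DecidableEq I]
    (A : Fin (2 ^ (n - 1)) → Matrix I I ℂ) :
    ∑ x, residualObs n A x * residualObs n A x =
      (2 : ℂ) ^ (n - 1) • ((2 : ℂ) ^ (n - 1) • ∑ x, A x * A x - ∑ y, primedObs n A y ^ 2) := by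
  set N : ℂ := 2 ^ (n - 1) with hN
  set P := primedObs n A with hP
  have hPdef (y) : P y = ∑ x, (bellSign n y x : ℂ) • A x := rfl
  have hleft : ∑ x, A x * ∑ y, (bellSign n y x : ℂ) • P y = ∑ y, P y ^ 2 := by
    simp_rw [Finset.mul_sum]
    rw [Finset.sum_comm]
    refine Finset.sum_congr rfl fun y _ => ?_
    rw [sq]
    nth_rw 2 [hPdef]
    simp [Finset.sum_mul]
  have hright : ∑ x, (∑ y, (bellSign n y x : ℂ) • P y) * A x = ∑ y, P y ^ 2 := by
    simp_rw [Finset.sum_mul]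
    rw [Finset.sum_comm]
    refine Finset.sum_congr rfl fun y _ => ?_
    rw [sq]
    nth_rw 3 [hPdef]
    simp [Finset.mul_sum]
  have horth (y z : Fin n) :
      ∑ x, (bellSign n y x : ℂ) * (bellSign n z x : ℂ) = if y = z then N else 0 := by
    have h := congrArg (fun r : ℝ => (r : ℂ)) (sum_bellSign_mul n y z)
    push_cast at h
    rw [h]
    split <;> simp [hN]
  have hcross : ∑ x, (∑ y, (bellSign n y x : ℂ) • P y) * (∑ z, (bellSign n z x : ℂ) • P z) =
      N • ∑ y, P y ^ 2 := by
    simp_rw [Finset.sum_mul_sum, smul_mul_smul_comm]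
    rw [Finset.sum_comm, Finset.smul_sum]
    refine Finset.sum_congr rfl fun y _ => ?_
    rw [Finset.sum_comm]
    simp_rw [← Finset.sum_smul, horth]
    simp [sq]
  have hexpand (x) : residualObs n A x * residualObs n A x =
      (N * N) • (A x * A x) - N • (A x * ∑ y, (bellSign n y x : ℂ) • P y)
        - N • ((∑ y, (bellSign n y x : ℂ) • P y) * A x)
        + (∑ y, (bellSign n y x : ℂ) • P y) * (∑ z, (bellSign n z x : ℂ) • P z) := by
    simp only [residualObs, ← hN, ← hP, sub_mul, mul_sub, smul_mul_assoc, mul_smul_comm, mul_smul, smul_sub]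
    abel
  simp_rw [hexpand, Finset.sum_add_distrib, Finset.sum_sub_distrib, ← Finset.smul_sum]
  rw [hleft, hright, hcross, smul_sub, mul_smul]
  abel

open scoped MatrixOrder Norms.L2Operator in
theorem re_trace_mul_nonneg {I : Type} [Fintype I] [DecidableEq I] {P ρ : Matrix I I ℂ}
    (hP : P.PosSemidef) (hρ : ρ.PosSemidef) : 0 ≤ (P * ρ).trace.re := by
  obtain ⟨B, rfl⟩ := CStarAlgebra.nonneg_iff_eq_star_mul_self.mp hρ.nonneg
  rw [star_eq_conjTranspose, ← mul_assoc, trace_mul_comm, ← mul_assoc]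
  exact (Complex.le_def.mp (hP.mul_mul_conjTranspose_same B).trace_nonneg).1

/-- `4^{n-1}·I − Σ_y (A'_y)²` is positive semidefinite; consequently
`Σ_y Tr[(A'_y)² ρ] ≤ 4^{n-1}` for every density matrix `ρ`. -/
theorem primed_square_sum_bound
    (n d : ℕ) (hn : 2 ≤ n)
    (A : Fin (2 ^ (n - 1)) → Matrix (Fin d) (Fin d) ℂ)
    (hA : ∀ x, IsDichotomic (A x)) :
    (((4 : ℂ) ^ (n - 1)) • (1 : Matrix (Fin d) (Fin d) ℂ) -
        ∑ y : Fin n, primedObs n A y ^ 2).PosSemidef ∧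
    ∀ ρ : Matrix (Fin d) (Fin d) ℂ, IsDensity ρ →
      (∑ y : Fin n, (((primedObs n A y ^ 2) * ρ).trace).re) ≤ (4 : ℝ) ^ (n - 1) := by
  have hpsd : (((4 : ℂ) ^ (n - 1)) • (1 : Matrix (Fin d) (Fin d) ℂ) -
      ∑ y : Fin n, primedObs n A y ^ 2).PosSemidef := by
    have hsum : (∑ x, residualObs n A x * residualObs n A x).PosSemidef :=
      posSemidef_sum _ fun x _ => by
        have h := posSemidef_conjTranspose_mul_self (residualObs n A x)
        rwa [(isHermitian_residualObs n (fun x => (hA x).1) x).eq] at h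
    have hinv : (0 : ℂ) ≤ ((2 : ℂ) ^ (n - 1))⁻¹ := by positivity
    have h := hsum.smul hinv
    rw [sum_residualObs_mul_self, inv_smul_smul₀ (by positivity)] at h
    have hfour : (2 : ℂ) ^ (n - 1) * 2 ^ (n - 1) = 4 ^ (n - 1) := by
      rw [← mul_pow]; norm_num
    simpa [(hA _).2, ← Nat.cast_smul_eq_nsmul ℂ, smul_smul, hfour] using h
  refine ⟨hpsd, fun ρ hρ => ?_⟩
  have h := re_trace_mul_nonneg hpsd hρ.1
  rw [sub_mul, trace_sub, smul_mul_assoc, one_mul, trace_smul, hρ.2, Finset.sum_mul, trace_sum,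
    Complex.sub_re, Complex.re_sum, smul_eq_mul, mul_one] at h
  have hre : ((4 : ℂ) ^ (n - 1)).re = 4 ^ (n - 1) := by
    exact_mod_cast Complex.ofReal_re ((4 : ℝ) ^ (n - 1))
  linarith
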